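/- arXiv:1708.09547 — 2 statements merged into one kernel-verified Lean document; each statement's English description precedes it below -/
import Mathlib

section
/- (Induction basis for the extra-special spectral transfer morphism, parameters m₋ = m₊ = 1/4.) Let r ≥ 1 and set T_{2i−1} = v s_i and T_{2i} = v^{−1} s_i for i = 1, …, r, with q = v². For c ∈ {1, 2} define D_c(x) := (1 − x)² / ((1 − q^c x)(1 − q^{−c} x)). Then the following exact identity of rational functions in ℚ(v, s₁, …, s_r) holds: ∏_{1 ≤ a < b ≤ 2r, {a,b} ∉ {{1,2},{3,4},…,{2r−1,2r}}} D₁(T_a T_b^{−1}) · ∏_{1 ≤ a < b ≤ 2r} D₁(T_a T_b) = ∏_{1 ≤ i < j ≤ r} D₂(s_i s_j^{−1}) · D₂(s_i s_j) · ∏_{i=1}^{r} D₁(s_i²). (The left-hand side is the regularized pullback, along ξ_{T,1/4,1/4}, of the type D_{2r} μ-function with parameter q, omitting the constant-root factors D₁(T_{2i−1}T_{2i}^{−1}) = D₁(q); the right-hand side is the type B_r μ-function with parameter q² and the short-root factor (1 − s_i²)²/((1 + v s_i)(1 + v^{−1}s_i)(1 − v s_i)(1 − v^{−1}s_i)).)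 -/
/-!
STATEMENT 5. Induction basis for the extra-special spectral transfer morphism
(`m₋ = m₊ = 1/4`): the regularized pullback along `ξ_{T,1/4,1/4}` of the type `D_{2r}`
μ-function with parameter `q` equals the type `B_r` μ-function with parameter `q²`.
Here `q = v²`, `T_{2i-1} = v s_i`, `T_{2i} = v⁻¹ s_i` (1-indexed; below 0-indexed:
`T_{2i} = v s_i`, `T_{2i+1} = v⁻¹ s_i`).
-/

noncomputable section

/-- The field `ℚ(v, s₁, s₂, …)` of rational functions. -/
abbrev RF5 : Type := FractionRing (MvPolynomial ℕ ℚ)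

/-- The indeterminate `v`. -/
def Vrf : RF5 := algebraMap (MvPolynomial ℕ ℚ) RF5 (MvPolynomial.X 0)

/-- The indeterminates `s_i` (0-indexed). -/
def Srf (i : ℕ) : RF5 := algebraMap (MvPolynomial ℕ ℚ) RF5 (MvPolynomial.X (i + 1))

/-- `D_c(x) = (1-x)²/((1-q^c x)(1-q^{-c} x))` with `q = v²`. -/
def Dfac (c : ℤ) (x : RF5) : RF5 :=
  (1 - x) ^ 2 / ((1 - (Vrf ^ 2) ^ c * x) * (1 - (Vrf ^ 2) ^ (-c) * x))

/-- The coordinates `T_0, T_1, …, T_{2r-1}`: `T_{2i} = v s_i`, `T_{2i+1} = v⁻¹ s_i`. -/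
def Tcoord (a : ℕ) : RF5 := if a % 2 = 0 then Vrf * Srf (a / 2) else Vrf⁻¹ * Srf (a / 2)

theorem prod_filter_lt_eq_prod_range {M : Type*} [CommMonoid M] (n : ℕ) (f : ℕ → ℕ → M) :
    ∏ p ∈ (Finset.range n ×ˢ Finset.range n).filter (fun p => p.1 < p.2), f p.1 p.2 =
      ∏ b ∈ Finset.range n, ∏ a ∈ Finset.range b, f a b := by
  rw [Finset.prod_filter, Finset.prod_product_right]
  refine Finset.prod_congr rfl fun b hb => ?_
  rw [← Finset.prod_filter]
  refine Finset.prod_congr ?_ fun _ _ => rfl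
  ext a
  simp only [Finset.mem_filter, Finset.mem_range] at hb ⊢
  omega

theorem prod_range_two_mul {M : Type*} [CommMonoid M] (n : ℕ) (f : ℕ → M) :
    ∏ a ∈ Finset.range (2 * n), f a = ∏ i ∈ Finset.range n, f (2 * i) * f (2 * i + 1) := by
  induction n with
  | zero => simp
  | succ n ih =>
    rw [Nat.mul_succ, Finset.prod_range_succ, Finset.prod_range_succ, ih,
      Finset.prod_range_succ, mul_assoc]

/-- Products over increasing pairs below `2 * r`, grouped into `2 × 2` blocks. -/
theorem prod_filter_lt_two_mul {M : Type*} [CommMonoid M] (r : ℕ) (f : ℕ → ℕ → M) :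
    ∏ p ∈ (Finset.range (2 * r) ×ˢ Finset.range (2 * r)).filter (fun p => p.1 < p.2),
        f p.1 p.2 =
      (∏ p ∈ (Finset.range r ×ˢ Finset.range r).filter (fun p => p.1 < p.2),
        (f (2 * p.1) (2 * p.2) * f (2 * p.1 + 1) (2 * p.2) *
          (f (2 * p.1) (2 * p.2 + 1) * f (2 * p.1 + 1) (2 * p.2 + 1)))) *
        ∏ i ∈ Finset.range r, f (2 * i) (2 * i + 1) := by
  rw [prod_filter_lt_eq_prod_range,
    prod_filter_lt_eq_prod_range r fun i j => f (2 * i) (2 * j) * f (2 * i + 1) (2 * j) *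
          (f (2 * i) (2 * j + 1) * f (2 * i + 1) (2 * j + 1)),
    prod_range_two_mul, ← Finset.prod_mul_distrib]
  refine Finset.prod_congr rfl fun j _ => ?_
  rw [Finset.prod_range_succ, prod_range_two_mul, prod_range_two_mul, ← mul_assoc,
    ← Finset.prod_mul_distrib]

theorem algebraMap_ne_of_eval_ne {P Q : MvPolynomial ℕ ℚ} (g : ℕ → ℚ)
    (h : MvPolynomial.eval g P ≠ MvPolynomial.eval g Q) :
    algebraMap (MvPolynomial ℕ ℚ) RF5 P ≠ algebraMap (MvPolynomial ℕ ℚ) RF5 Q :=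
  fun e => h (congrArg _ (IsFractionRing.injective (MvPolynomial ℕ ℚ) RF5 e))

theorem Vrf_ne_zero : Vrf ≠ 0 := by
  rw [Vrf, ← map_zero (algebraMap (MvPolynomial ℕ ℚ) RF5)]
  exact algebraMap_ne_of_eval_ne (fun _ => 1) (by simp)

theorem Srf_ne_zero (i : ℕ) : Srf i ≠ 0 := by
  rw [Srf, ← map_zero (algebraMap (MvPolynomial ℕ ℚ) RF5)]
  exact algebraMap_ne_of_eval_ne (fun _ => 1) (by simp)

theorem Vrf_pow_mul_Srf_ne {i j : ℕ} (hij : i ≠ j) (m n : ℕ) :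
    Vrf ^ m * Srf i ≠ Vrf ^ n * Srf j := by
  simp only [Vrf, Srf, ← map_mul, ← map_pow]
  exact algebraMap_ne_of_eval_ne (fun k => if k = i + 1 then 2 else 1) (by simp [hij.symm])

theorem Vrf_pow_mul_Srf_mul_Srf_ne {i j : ℕ} (hij : i ≠ j) (m n : ℕ) :
    Vrf ^ m * (Srf i * Srf j) ≠ Vrf ^ n := by
  simp only [Vrf, Srf, ← map_mul, ← map_pow]
  exact algebraMap_ne_of_eval_ne (fun k => if k = i + 1 then 2 else 1) (by simp [hij.symm])

/-- The four factors `D₁` of a block telescope to `D₂`. -/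
theorem Dfac_one_block {x : RF5} (h : ∀ m n : ℕ, Vrf ^ m * x ≠ Vrf ^ n) :
    Dfac 1 x ^ 2 * Dfac 1 (Vrf ^ 2 * x) * Dfac 1 ((Vrf ^ 2)⁻¹ * x) = Dfac 2 x := by
  have hv := Vrf_ne_zero
  have h0 : 1 - x ≠ 0 := sub_ne_zero.2 fun e => h 0 0 (by simp [← e])
  have h1 : 1 - Vrf ^ 2 * x ≠ 0 := sub_ne_zero.2 fun e => h 2 0 (by simp [← e])
  have h2 : 1 - (Vrf ^ 2)⁻¹ * x ≠ 0 := sub_ne_zero.2 fun e => h 0 2 (by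
    rw [eq_inv_mul_iff_mul_eq₀ (pow_ne_zero 2 hv)] at e
    simpa using e.symm)
  have e1 : (Vrf ^ 2) ^ (2 : ℤ) = Vrf ^ 2 * Vrf ^ 2 := by rw [zpow_ofNat, pow_two]
  have e2 : (Vrf ^ 2) ^ (-2 : ℤ) = (Vrf ^ 2)⁻¹ * (Vrf ^ 2)⁻¹ := by
    rw [zpow_neg, e1, mul_inv]
  have hq : Vrf ^ 2 ≠ 0 := pow_ne_zero 2 hv
  simp only [Dfac, e1, e2, zpow_one, zpow_neg, ← mul_assoc, mul_inv_cancel₀ hq,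
    inv_mul_cancel₀ hq, one_mul]
  generalize 1 - Vrf ^ 2 * Vrf ^ 2 * x = D
  generalize 1 - (Vrf ^ 2)⁻¹ * (Vrf ^ 2)⁻¹ * x = E
  generalize 1 - Vrf ^ 2 * x = B at *
  generalize 1 - (Vrf ^ 2)⁻¹ * x = C at *
  generalize 1 - x = A at *
  field_simp

theorem Tcoord_even (i : ℕ) : Tcoord (2 * i) = Vrf * Srf i := by
  simp [Tcoord]

theorem Tcoord_odd (i : ℕ) : Tcoord (2 * i + 1) = Vrf⁻¹ * Srf i := by
  have h : (2 * i + 1) / 2 = i := by omega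
  simp [Tcoord, Nat.add_mod, h]

theorem Dfac_Tcoord_inv_block {i j : ℕ} (hij : i ≠ j) :
    Dfac 1 (Tcoord (2 * i) * (Tcoord (2 * j))⁻¹) *
        Dfac 1 (Tcoord (2 * i + 1) * (Tcoord (2 * j))⁻¹) *
      (Dfac 1 (Tcoord (2 * i) * (Tcoord (2 * j + 1))⁻¹) *
        Dfac 1 (Tcoord (2 * i + 1) * (Tcoord (2 * j + 1))⁻¹)) =
      Dfac 2 (Srf i * (Srf j)⁻¹) := by
  have hv := Vrf_ne_zero
  have hs := Srf_ne_zero j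
  rw [← Dfac_one_block (x := Srf i * (Srf j)⁻¹) fun m n e =>
    Vrf_pow_mul_Srf_ne hij m n (by rw [← e]; field_simp)]
  simp only [Tcoord_even, Tcoord_odd]
  have a1 : Vrf * Srf i * (Vrf * Srf j)⁻¹ = Srf i * (Srf j)⁻¹ := by field_simp
  have a2 : Vrf⁻¹ * Srf i * (Vrf * Srf j)⁻¹ = (Vrf ^ 2)⁻¹ * (Srf i * (Srf j)⁻¹) := by
    field_simp
  have a3 : Vrf * Srf i * (Vrf⁻¹ * Srf j)⁻¹ = Vrf ^ 2 * (Srf i * (Srf j)⁻¹) := by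
    field_simp
  have a4 : Vrf⁻¹ * Srf i * (Vrf⁻¹ * Srf j)⁻¹ = Srf i * (Srf j)⁻¹ := by field_simp
  rw [a1, a2, a3, a4]
  ring

theorem Dfac_Tcoord_mul_block {i j : ℕ} (hij : i ≠ j) :
    Dfac 1 (Tcoord (2 * i) * Tcoord (2 * j)) *
        Dfac 1 (Tcoord (2 * i + 1) * Tcoord (2 * j)) *
      (Dfac 1 (Tcoord (2 * i) * Tcoord (2 * j + 1)) *
        Dfac 1 (Tcoord (2 * i + 1) * Tcoord (2 * j + 1))) =
      Dfac 2 (Srf i * Srf j) := by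
  have hv := Vrf_ne_zero
  rw [← Dfac_one_block (Vrf_pow_mul_Srf_mul_Srf_ne hij)]
  simp only [Tcoord_even, Tcoord_odd]
  have a1 : Vrf * Srf i * (Vrf * Srf j) = Vrf ^ 2 * (Srf i * Srf j) := by ring
  have a2 : Vrf⁻¹ * Srf i * (Vrf * Srf j) = Srf i * Srf j := by field_simp
  have a3 : Vrf * Srf i * (Vrf⁻¹ * Srf j) = Srf i * Srf j := by field_simp
  have a4 : Vrf⁻¹ * Srf i * (Vrf⁻¹ * Srf j) = (Vrf ^ 2)⁻¹ * (Srf i * Srf j) := by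
    field_simp
  rw [a1, a2, a3, a4]
  ring

/-- for every `r ≥ 1`,
`∏_{a<b, {a,b} not coupled} D₁(T_a T_b⁻¹) · ∏_{a<b} D₁(T_a T_b)
  = ∏_{i<j} D₂(s_i s_j⁻¹) D₂(s_i s_j) · ∏_i D₁(s_i²)`,
where a pair is *coupled* when it is of the form `{2i, 2i+1}` (0-indexed), i.e. both
coordinates come from the same `s_i`. -/
theorem statement5 (r : ℕ) (hr : 1 ≤ r) :
    (∏ p ∈ (Finset.range (2 * r) ×ˢ Finset.range (2 * r)).filter
        (fun p => p.1 < p.2 ∧ ¬(p.1 % 2 = 0 ∧ p.2 = p.1 + 1)),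
        Dfac 1 (Tcoord p.1 * (Tcoord p.2)⁻¹)) *
      ∏ p ∈ (Finset.range (2 * r) ×ˢ Finset.range (2 * r)).filter (fun p => p.1 < p.2),
        Dfac 1 (Tcoord p.1 * Tcoord p.2) =
    (∏ p ∈ (Finset.range r ×ˢ Finset.range r).filter (fun p => p.1 < p.2),
        (Dfac 2 (Srf p.1 * (Srf p.2)⁻¹) * Dfac 2 (Srf p.1 * Srf p.2))) *
      ∏ i ∈ Finset.range r, Dfac 1 (Srf i ^ 2) := by
  rw [← Finset.filter_filter, Finset.prod_filter,
    prod_filter_lt_two_mul r fun a b => if ¬(a % 2 = 0 ∧ b = a + 1) then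
      Dfac 1 (Tcoord a * (Tcoord b)⁻¹) else 1,
    prod_filter_lt_two_mul r fun a b => Dfac 1 (Tcoord a * Tcoord b)]
  have hdiag : ∏ i ∈ Finset.range r, (if ¬((2 * i) % 2 = 0 ∧ 2 * i + 1 = 2 * i + 1) then
      Dfac 1 (Tcoord (2 * i) * (Tcoord (2 * i + 1))⁻¹) else 1) = 1 :=
    Finset.prod_eq_one fun i _ => by simp
  rw [hdiag, mul_one, ← mul_assoc, ← Finset.prod_mul_distrib]
  congr 1
  · refine Finset.prod_congr rfl fun p hp => ?_
    have hlt : p.1 < p.2 := (Finset.mem_filter.1 hp).2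
    rw [if_pos (by omega), if_pos (by omega), if_pos (by omega), if_pos (by omega),
      Dfac_Tcoord_inv_block hlt.ne, Dfac_Tcoord_mul_block hlt.ne]
  · refine Finset.prod_congr rfl fun i _ => ?_
    have hv := Vrf_ne_zero
    rw [Tcoord_even, Tcoord_odd]
    congr 1
    field_simp
end
end

section
/- Let m₋, m₊ ∈ ℤ ± 1/4 with m₊ ≥ m₋ > 0 and m₊ > 1. Then the following exact identity holds in ℚ(q): ∏_{u ∈ r_e(m₋)} (1 + q^{A₊} u^{−1})(1 + q^{A₊} u) / ((1 + q^{A₊+1} u^{−1})(1 + q^{A₊+1} u)) = ((1 + q^{A₊ + ε₋})/(1 + q^{A₊ + 1 − ε₋}))^{e} · ∏_{i=1}^{κ₋ − 1 + ε₋} (1 + q^{A₊ − 2i + ε₋}) / (1 + q^{A₊ + 2i + 1 − ε₋}), where e = 1 if ε₋ = δ₋ and e = 0 otherwise. (The trailing product telescopes the factors (1 + q^{A₊ − 2 + ε₋})(1 + q^{A₊ − 4 + ε₋}) ⋯ (1 + q^{A₊ − A₋}) over (1 + q^{A₊ + 3 − ε₋})(1 + q^{A₊ + 5 − ε₋}) ⋯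 (1 + q^{A₊ + A₋ + 1}); the left-hand side is the factor (P2) in the rank-zero extra-special computation.) -/
/-!
STATEMENT 8. The factor `(P2)` of the rank-zero extra-special computation:
`∏_{u ∈ r_e(m₋)} (1+q^{A₊}u⁻¹)(1+q^{A₊}u)/((1+q^{A₊+1}u⁻¹)(1+q^{A₊+1}u))
 = ((1+q^{A₊+ε₋})/(1+q^{A₊+1-ε₋}))^e · ∏_{i=1}^{κ₋-1+ε₋} (1+q^{A₊-2i+ε₋})/(1+q^{A₊+2i+1-ε₋})`
with `e = 1` iff `ε₋ = δ₋`.  The coordinates of `r_e(m)` are powers of `q`; we record the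
exponents: `σ_e(m)` has exponents `δ(m), δ(m)+1, …, A(m)` with `A(m) = 2(κ(m)-1)+ε(m)` and
`δ(m) = κ(m) mod 2`, and `r_e(m) = σ_e(m) ++ r_e(m-1)` with `r_e(1/4) = r_e(3/4) = ∅`.
-/

noncomputable section

/-- The field `ℚ(q)`. -/
abbrev RF8 : Type := RatFunc ℚ

/-- The indeterminate `q`. -/
def qR : RF8 := RatFunc.X

/-- Exponents of the coordinates of `σ_e(m)` for `m = κ + (2ε-1)/4`:
the integers from `δ(m) = κ % 2` to `A(m) = 2κ - 2 + ε`. -/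
def sigmaExp (ε κ : ℕ) : Multiset ℤ := (Finset.Icc ((κ : ℤ) % 2) (2 * (κ : ℤ) - 2 + ε)).val

/-- Exponents of the coordinates of `r_e(m)` for `m = κ + (2ε-1)/4`
(recursion `r_e(m) = σ_e(m) ++ r_e(m-1)`, empty in the base cases `κ = 0` and `m = 3/4`). -/
def reExp (ε : ℕ) : ℕ → Multiset ℤ
  | 0 => 0
  | κ + 1 => sigmaExp ε (κ + 1) + reExp ε κ

theorem qR_ne_zero : qR ≠ 0 := RatFunc.X_ne_zero

theorem one_add_qR_pow_ne_zero (n : ℕ) : 1 + qR ^ n ≠ 0 := by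
  have hp : (1 + Polynomial.X ^ n : Polynomial ℚ) ≠ 0 := by
    intro h
    have := congrArg (Polynomial.eval 1) h
    norm_num at this
  have h := RatFunc.algebraMap_ne_zero hp
  simpa [qR, RatFunc.algebraMap_X] using h

theorem one_add_qR_zpow_ne_zero (x : ℤ) : 1 + qR ^ x ≠ 0 := by
  obtain ⟨n, rfl | rfl⟩ := x.eq_nat_or_neg
  · simpa using one_add_qR_pow_ne_zero n
  · have h : 1 + qR ^ (-(n : ℤ)) = (1 + qR ^ n) * (qR ^ n)⁻¹ := by
      rw [zpow_neg, zpow_natCast]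
      field_simp [qR_ne_zero]
      ring
    rw [h]
    exact mul_ne_zero (one_add_qR_pow_ne_zero n) (inv_ne_zero (pow_ne_zero _ qR_ne_zero))

/-- The product over a string of consecutive exponents telescopes. -/
theorem prod_Icc_telescope (A d : ℤ) (n : ℕ) :
    ∏ e ∈ Finset.Icc d (d + n - 1),
        (1 + qR ^ A * (qR ^ e)⁻¹) * (1 + qR ^ A * qR ^ e) /
          ((1 + qR ^ (A + 1) * (qR ^ e)⁻¹) * (1 + qR ^ (A + 1) * qR ^ e)) =
      (1 + qR ^ (A + 1 - d - n)) * (1 + qR ^ (A + d)) /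
        ((1 + qR ^ (A + 1 - d)) * (1 + qR ^ (A + d + n))) := by
  induction n with
  | zero =>
    have h₁ := one_add_qR_zpow_ne_zero (A + 1 - d)
    have h₂ := one_add_qR_zpow_ne_zero (A + d)
    simp [div_self (mul_ne_zero h₁ h₂)]
  | succ n ih =>
    have hI : Finset.Icc d (d + (n + 1 : ℕ) - 1) =
        insert (d + (n : ℤ)) (Finset.Icc d (d + n - 1)) := by
      ext x
      simp only [Finset.mem_Icc, Finset.mem_insert]
      push_cast
      omega
    rw [hI, Finset.prod_insert (by simp), ih]
    simp only [← zpow_neg, ← zpow_add₀ qR_ne_zero]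
    have e₁ : A + -(d + (n : ℤ)) = A + 1 - d - (n + 1 : ℕ) := by push_cast; ring
    have e₂ : A + (d + (n : ℤ)) = A + d + n := by ring
    have e₃ : A + 1 + -(d + (n : ℤ)) = A + 1 - d - n := by ring
    have e₄ : A + 1 + (d + (n : ℤ)) = A + d + (n + 1 : ℕ) := by push_cast; ring
    rw [e₁, e₂, e₃, e₄]
    have h₁ := one_add_qR_zpow_ne_zero (A + 1 - d - n)
    have h₂ := one_add_qR_zpow_ne_zero (A + d + n)
    have h₃ := one_add_qR_zpow_ne_zero (A + d + (n + 1 : ℕ))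
    have h₄ := one_add_qR_zpow_ne_zero (A + 1 - d)
    generalize 1 + qR ^ (A + 1 - d - n) = a at *
    generalize 1 + qR ^ (A + d + n) = b at *
    generalize 1 + qR ^ (A + d + (n + 1 : ℕ)) = c at *
    generalize 1 + qR ^ (A + 1 - d) = f at *
    field_simp

theorem prod_sigmaExp_succ (A : ℤ) (ε κ : ℕ) :
    ((sigmaExp ε (κ + 1)).map fun e =>
        (1 + qR ^ A * (qR ^ e)⁻¹) * (1 + qR ^ A * qR ^ e) /
          ((1 + qR ^ (A + 1) * (qR ^ e)⁻¹) * (1 + qR ^ (A + 1) * qR ^ e))).prod =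
      (1 + qR ^ (A - 2 * κ - ε)) * (1 + qR ^ (A + ((κ + 1 : ℕ) : ℤ) % 2)) /
        ((1 + qR ^ (A + 1 - ((κ + 1 : ℕ) : ℤ) % 2)) * (1 + qR ^ (A + 2 * κ + ε + 1))) := by
  have H := prod_Icc_telescope A (((κ + 1 : ℕ) : ℤ) % 2) (2 * κ + ε + 1 - (κ + 1) % 2)
  have hn : ((2 * κ + ε + 1 - (κ + 1) % 2 : ℕ) : ℤ) =
      2 * κ + ε + 1 - ((κ + 1 : ℕ) : ℤ) % 2 := by omega
  rw [hn] at H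
  have e₁ : ((κ + 1 : ℕ) : ℤ) % 2 + (2 * κ + ε + 1 - ((κ + 1 : ℕ) : ℤ) % 2) - 1 =
      2 * ((κ + 1 : ℕ) : ℤ) - 2 + ε := by push_cast; ring
  have e₂ : A + 1 - ((κ + 1 : ℕ) : ℤ) % 2 - (2 * κ + ε + 1 - ((κ + 1 : ℕ) : ℤ) % 2) =
      A - 2 * κ - ε := by ring
  have e₃ : A + ((κ + 1 : ℕ) : ℤ) % 2 + (2 * κ + ε + 1 - ((κ + 1 : ℕ) : ℤ) % 2) =
      A + 2 * κ + ε + 1 := by ring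
  rw [e₁, e₂, e₃] at H
  exact H

theorem prod_reExp (A : ℤ) {ε : ℕ} (hε : ε = 0 ∨ ε = 1) (κ : ℕ) (h : 1 ≤ κ + ε) :
    ((reExp ε κ).map fun e =>
        (1 + qR ^ A * (qR ^ e)⁻¹) * (1 + qR ^ A * qR ^ e) /
          ((1 + qR ^ (A + 1) * (qR ^ e)⁻¹) * (1 + qR ^ (A + 1) * qR ^ e))).prod =
      ((1 + qR ^ (A + ε)) / (1 + qR ^ (A + 1 - ε))) ^ (if ε = κ % 2 then 1 else 0) *
        ∏ i ∈ Finset.Icc 1 (κ + ε - 1),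
          (1 + qR ^ (A - 2 * (i : ℤ) + ε)) / (1 + qR ^ (A + 2 * (i : ℤ) + 1 - ε)) := by
  induction κ with
  | zero =>
    obtain rfl : ε = 1 := by omega
    simp [reExp]
  | succ κ ih =>
    rw [reExp, Multiset.map_add, Multiset.prod_add, prod_sigmaExp_succ]
    have hA := one_add_qR_zpow_ne_zero A
    have hA' := one_add_qR_zpow_ne_zero (A + 1)
    rcases Nat.eq_zero_or_pos (κ + ε) with h0 | hpos
    · obtain ⟨rfl, rfl⟩ : κ = 0 ∧ ε = 0 := by omega
      simp [reExp, hA, hA']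
    · rw [ih hpos]
      have hI : κ + 1 + ε - 1 = (κ + ε - 1) + 1 := by omega
      have hc : κ + ε - 1 + 1 = κ + ε := by omega
      rw [hI, Finset.prod_Icc_succ_top (by omega), hc]
      have e₁ : A - 2 * ((κ + ε : ℕ) : ℤ) + ε = A - 2 * κ - ε := by push_cast; ring
      have e₂ : A + 2 * ((κ + ε : ℕ) : ℤ) + 1 - ε = A + 2 * κ + ε + 1 := by push_cast; ring
      rw [e₁, e₂]
      have h₁ := one_add_qR_zpow_ne_zero (A + 2 * κ + ε + 1)
      generalize 1 + qR ^ (A + 2 * κ + ε + 1) = a at *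
      generalize 1 + qR ^ (A - 2 * κ - ε) = b at *
      generalize (∏ i ∈ Finset.Icc 1 (κ + ε - 1),
          (1 + qR ^ (A - 2 * (i : ℤ) + ε)) / (1 + qR ^ (A + 2 * (i : ℤ) + 1 - ε))) = P at *
      rcases Nat.mod_two_eq_zero_or_one κ with hk | hk
      · have hk₁ : (κ + 1) % 2 = 1 := by omega
        have hk₂ : ((κ + 1 : ℕ) : ℤ) % 2 = 1 := by omega
        rw [hk, hk₁, hk₂]
        rcases hε with rfl | rfl <;> simp <;> field_simp
      · have hk₁ : (κ + 1) % 2 = 0 := by omega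
        have hk₂ : ((κ + 1 : ℕ) : ℤ) % 2 = 0 := by omega
        rw [hk, hk₁, hk₂]
        rcases hε with rfl | rfl <;> simp <;> field_simp

theorem statement8 (κm κp εm εp δm : ℕ) (hεm : εm = 0 ∨ εm = 1) (hεp : εp = 0 ∨ εp = 1)
    (hδm : δm = κm % 2)
    (mminus mplus : ℚ)
    (hmm : mminus = κm + (2 * (εm : ℚ) - 1) / 4)
    (hmp : mplus = κp + (2 * (εp : ℚ) - 1) / 4)
    (h0 : 0 < mminus) (hle : mminus ≤ mplus) (h1 : 1 < mplus)
    (A : ℤ) (hA : A = 2 * (κp : ℤ) - 2 + εp) :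
    ((reExp εm κm).map fun e =>
        (1 + qR ^ A * (qR ^ e)⁻¹) * (1 + qR ^ A * qR ^ e) /
          ((1 + qR ^ (A + 1) * (qR ^ e)⁻¹) * (1 + qR ^ (A + 1) * qR ^ e))).prod =
      ((1 + qR ^ (A + εm)) / (1 + qR ^ (A + 1 - εm))) ^ (if εm = δm then 1 else 0) *
        ∏ i ∈ Finset.Icc 1 (κm + εm - 1),
          (1 + qR ^ (A - 2 * (i : ℤ) + εm)) / (1 + qR ^ (A + 2 * (i : ℤ) + 1 - εm)) := by
  subst hδm
  refine prod_reExp A hεm κm ?_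
  by_contra hlt
  obtain ⟨rfl, rfl⟩ : κm = 0 ∧ εm = 0 := by omega
  norm_num at hmm
  linarith
end
end
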